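/- Let ρ be any GAO for Q and let B be a private attribute of some relation R, i.e., B occurs in no other relation of Q. Let ρ′ be the attribute order obtained from ρ by removing B and appending it at the end. For a fixed database, let C(ρ) and C(ρ′) denote minimum-size certificates with respect to the database indexed consistently with ρ and with ρ′, respectively. Then |C(ρ′)| ≤ |C(ρ)|. -/

import Mathlib

/-! Core model of indexed natural-join queries, arguments and certificates. -/

/-- `x` is a valid index tuple for a search tree with fanout function `f` and depth
(arity) `ar`: it is nonempty, of length at most `ar`, and every coordinate is `1`-based
and within the fanout of the corresponding prefix. -/
def ValidIdx (f : List ℕ → ℕ) (ar : ℕ) (x : List ℕ) : Prop :=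
  x ≠ [] ∧ x.length ≤ ar ∧
    ∀ j : Fin x.length, 1 ≤ x.get j ∧ x.get j ≤ f (x.take j.val)

/-- `v` is a valid valuation (a "database instance") for the search-tree shape `(f, ar)`:
the values assigned to the children of a common prefix strictly increase. -/
def IsInstVal (f : List ℕ → ℕ) (ar : ℕ) (v : List ℕ → ℕ) : Prop :=
  ∀ (x : List ℕ) (i : ℕ), ValidIdx f ar (x ++ [i]) → ValidIdx f ar (x ++ [i + 1]) →
    v (x ++ [i]) < v (x ++ [i + 1])

/-- A symbolic comparison `R[x] θ S[y]` between two variables, `θ ∈ {<, =, >}`. -/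
structure Comp (ι : Type) where
  R : ι
  x : List ℕ
  S : ι
  y : List ℕ
  o : Ordering
deriving DecidableEq

variable {n : ℕ} {ι : Type}

/-- The list of attributes of relation `R`, in the order of the GAO `ρ`. -/
def attrList (attrs : ι → Finset (Fin n)) (ρ : List (Fin n)) (R : ι) : List (Fin n) :=
  ρ.filter (fun a => decide (a ∈ attrs R))

/-- The arity of relation `R`. -/
def arity (attrs : ι → Finset (Fin n)) (ρ : List (Fin n)) (R : ι) : ℕ :=
  (attrList attrs ρ R).length

/-- Well-formedness of a comparison: both index tuples are valid, and the two variables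
are on the same attribute. -/
def CompWF (attrs : ι → Finset (Fin n)) (ρ : List (Fin n)) (f : ι → List ℕ → ℕ)
    (c : Comp ι) : Prop :=
  ValidIdx (f c.R) (arity attrs ρ c.R) c.x ∧
  ValidIdx (f c.S) (arity attrs ρ c.S) c.y ∧
  (attrList attrs ρ c.R)[c.x.length - 1]? = (attrList attrs ρ c.S)[c.y.length - 1]?

/-- The valuation `v` satisfies the comparison `c`. -/
def SatComp (v : ι → List ℕ → ℕ) (c : Comp ι) : Prop :=
  compare (v c.R c.x) (v c.S c.y) = c.o

/-- `W` is a witness: one full valid index tuple per relation, all contributing to a common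
output tuple `t`. -/
def IsWitness (attrs : ι → Finset (Fin n)) (ρ : List (Fin n)) (f : ι → List ℕ → ℕ)
    (v : ι → List ℕ → ℕ) (W : ι → List ℕ) : Prop :=
  (∀ R, ValidIdx (f R) (arity attrs ρ R) (W R) ∧ (W R).length = arity attrs ρ R) ∧
  ∃ t : Fin n → ℕ, ∀ (R : ι) (j : ℕ) (a : Fin n),
    (attrList attrs ρ R)[j]? = some a → v R ((W R).take (j + 1)) = t a

/-- `A` is a certificate for the shape `f`: all its comparisons are well-formed, and any two
valuations (database instances with this index structure) satisfying all comparisons of `A`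
have exactly the same witnesses. -/
def IsCert (attrs : ι → Finset (Fin n)) (ρ : List (Fin n)) (f : ι → List ℕ → ℕ)
    (A : Finset (Comp ι)) : Prop :=
  (∀ c ∈ A, CompWF attrs ρ f c) ∧
  ∀ v v' : ι → List ℕ → ℕ,
    (∀ R, IsInstVal (f R) (arity attrs ρ R) (v R)) →
    (∀ R, IsInstVal (f R) (arity attrs ρ R) (v' R)) →
    (∀ c ∈ A, SatComp v c) → (∀ c ∈ A, SatComp v' c) →
    ∀ W, IsWitness attrs ρ f v W ↔ IsWitness attrs ρ f v' W

/-! The search tree (trie) derived from raw relational data. -/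

/-- The `k`-th smallest element of a finite set of naturals (`1`-based). -/
def nthVal (s : Finset ℕ) (k : ℕ) : ℕ := (s.sort (· ≤ ·)).getD (k - 1) 0

/-- The list of values along the path of index tuple `x` in the search tree of the data
`D` with attribute list `L`. -/
def dbValList : List ℕ → Finset (Fin n → ℕ) → List (Fin n) → List ℕ
  | [], _, _ => []
  | _ :: _, _, [] => []
  | i :: xs, D, a :: L' =>
    let w := nthVal (D.image (fun t => t a)) i
    w :: dbValList xs (D.filter (fun t => t a = w)) L'

/-- The fanout below index tuple `x` in the search tree of the data `D` with attribute
list `L`. -/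
def dbFanout : List ℕ → Finset (Fin n → ℕ) → List (Fin n) → ℕ
  | _, _, [] => 0
  | [], D, a :: _ => (D.image (fun t => t a)).card
  | i :: xs, D, a :: L' =>
    let w := nthVal (D.image (fun t => t a)) i
    dbFanout xs (D.filter (fun t => t a = w)) L'

/-- The index structure (shape) of the database `DB`, indexed consistently with the GAO
`ρ`. -/
def dbShape (attrs : ι → Finset (Fin n)) (ρ : List (Fin n))
    (DB : ι → Finset (Fin n → ℕ)) : ι → List ℕ → ℕ :=
  fun R x => dbFanout x (DB R) (attrList attrs ρ R)

/-- The value of the variable `R[x]` in the search trees of the database `DB`, indexed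
consistently with the GAO `ρ`. -/
def dbValue (attrs : ι → Finset (Fin n)) (ρ : List (Fin n))
    (DB : ι → Finset (Fin n → ℕ)) : ι → List ℕ → ℕ :=
  fun R x => (dbValList x (DB R) (attrList attrs ρ R)).getD (x.length - 1) 0

/-! Coding tuples of a finite set by their index tuples in the search tree. -/

/-- The `1`-based rank of `k` in the finite set `s`. -/
def rankIn (s : Finset ℕ) (k : ℕ) : ℕ := (s.sort (· ≤ ·)).idxOf k + 1

lemma nthVal_rankIn {s : Finset ℕ} {k : ℕ} (hk : k ∈ s) : nthVal s (rankIn s k) = k := by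
  have h : (s.sort (· ≤ ·)).idxOf k < (s.sort (· ≤ ·)).length :=
    List.idxOf_lt_length_iff.2 ((Finset.mem_sort _).2 hk)
  rw [nthVal, rankIn, Nat.add_sub_cancel, List.getD_eq_getElem _ _ h, List.getElem_idxOf h]

lemma rankIn_le_card {s : Finset ℕ} {k : ℕ} (hk : k ∈ s) : rankIn s k ≤ s.card := by
  have h : (s.sort (· ≤ ·)).idxOf k < (s.sort (· ≤ ·)).length :=
    List.idxOf_lt_length_iff.2 ((Finset.mem_sort _).2 hk)
  rw [Finset.length_sort] at h
  exact h

lemma one_le_rankIn (s : Finset ℕ) (k : ℕ) : 1 ≤ rankIn s k := Nat.le_add_left _ _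

lemma nthVal_mem {s : Finset ℕ} {i : ℕ} (h1 : 1 ≤ i) (h2 : i ≤ s.card) : nthVal s i ∈ s := by
  have h : i - 1 < (s.sort (· ≤ ·)).length := by rw [Finset.length_sort]; omega
  rw [nthVal, List.getD_eq_getElem _ _ h]
  exact (Finset.mem_sort (· ≤ ·)).1 (List.getElem_mem h)

lemma rankIn_nthVal {s : Finset ℕ} {i : ℕ} (h1 : 1 ≤ i) (h2 : i ≤ s.card) :
    rankIn s (nthVal s i) = i := by
  have h : i - 1 < (s.sort (· ≤ ·)).length := by rw [Finset.length_sort]; omega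
  rw [rankIn, nthVal, List.getD_eq_getElem _ _ h, (s.sort_nodup (· ≤ ·)).idxOf_getElem]
  omega

lemma nthVal_lt_nthVal {s : Finset ℕ} {i k : ℕ} (h1 : 1 ≤ i) (hik : i < k) (h2 : k ≤ s.card) :
    nthVal s i < nthVal s k := by
  have hi : i - 1 < (s.sort (· ≤ ·)).length := by rw [Finset.length_sort]; omega
  have hk : k - 1 < (s.sort (· ≤ ·)).length := by rw [Finset.length_sort]; omega
  rw [nthVal, nthVal, List.getD_eq_getElem _ _ hi, List.getD_eq_getElem _ _ hk]
  exact s.sortedLT_sort.getElem_lt_getElem_of_lt (by omega)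

lemma rankIn_lt_iff {s : Finset ℕ} {k l : ℕ} (hk : k ∈ s) (hl : l ∈ s) :
    rankIn s k < rankIn s l ↔ k < l := by
  have key : ∀ {k l : ℕ}, k ∈ s → l ∈ s → rankIn s k < rankIn s l → k < l := by
    intro k l hk hl h
    have := nthVal_lt_nthVal (one_le_rankIn s k) h (rankIn_le_card hl)
    rwa [nthVal_rankIn hk, nthVal_rankIn hl] at this
  refine ⟨key hk hl, fun h => ?_⟩
  rcases lt_trichotomy (rankIn s k) (rankIn s l) with h' | h' | h'
  · exact h'
  · have := congrArg (nthVal s) h'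
    rw [nthVal_rankIn hk, nthVal_rankIn hl] at this
    omega
  · have := key hl hk h'
    omega

/-- The full index tuple of the tuple `t` in the search tree of `D` with attribute list `L`. -/
def tupleCode {n : ℕ} (t : Fin n → ℕ) : Finset (Fin n → ℕ) → List (Fin n) → List ℕ
  | _, [] => []
  | D, a :: L =>
    rankIn (D.image (fun s => s a)) (t a) :: tupleCode t (D.filter (fun s => s a = t a)) L

lemma length_tupleCode {n : ℕ} (t : Fin n → ℕ) (L : List (Fin n)) (D : Finset (Fin n → ℕ)) :
    (tupleCode t D L).length = L.length := by
  induction L generalizing D with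
  | nil => rfl
  | cons a L ih => simp [tupleCode, ih]

lemma dbValList_take_tupleCode {n : ℕ} {t : Fin n → ℕ} (L : List (Fin n))
    {D : Finset (Fin n → ℕ)} (ht : t ∈ D) (j : ℕ) :
    dbValList ((tupleCode t D L).take j) D L = (L.take j).map t := by
  induction L generalizing D j with
  | nil => simp [tupleCode, dbValList]
  | cons a L ih =>
    cases j with
    | zero => simp [dbValList]
    | succ j =>
      have hw := nthVal_rankIn (Finset.mem_image_of_mem (fun s : Fin n → ℕ => s a) ht)
      simp only [tupleCode, List.take_succ_cons, dbValList, List.map_cons]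
      rw [hw, ih (D := D.filter (fun u => u a = t a)) (Finset.mem_filter.2 ⟨ht, rfl⟩)]

lemma take_tupleCode_eq_iff {n : ℕ} {t s : Fin n → ℕ} (L : List (Fin n))
    {D : Finset (Fin n → ℕ)} (ht : t ∈ D) (hs : s ∈ D) (j : ℕ) :
    (tupleCode t D L).take j = (tupleCode s D L).take j ↔ ∀ b ∈ L.take j, t b = s b := by
  constructor
  · intro h
    have := dbValList_take_tupleCode L ht j
    rw [h, dbValList_take_tupleCode L hs j] at this
    exact fun b hb => (List.map_inj_left.1 this b hb).symm
  · intro h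
    induction L generalizing D j with
    | nil => simp [tupleCode]
    | cons a L ih =>
      cases j with
      | zero => simp
      | succ j =>
        simp only [List.take_succ_cons, List.mem_cons, forall_eq_or_imp] at h
        simp only [tupleCode, List.take_succ_cons, h.1]
        rw [ih (D := D.filter (fun u => u a = s a)) (Finset.mem_filter.2 ⟨ht, h.1⟩)
          (Finset.mem_filter.2 ⟨hs, rfl⟩) j h.2]

lemma tupleCode_getElem_lt_iff {n : ℕ} {t s : Fin n → ℕ} (L : List (Fin n))
    {D : Finset (Fin n → ℕ)} (ht : t ∈ D) (hs : s ∈ D) (j : ℕ) (hj : j < L.length)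
    (h : ∀ b ∈ L.take j, t b = s b) :
    (tupleCode t D L)[j]'(by rwa [length_tupleCode]) <
      (tupleCode s D L)[j]'(by rwa [length_tupleCode]) ↔ t L[j] < s L[j] := by
  induction L generalizing D j with
  | nil => simp at hj
  | cons a L ih =>
    cases j with
    | zero =>
      exact rankIn_lt_iff (Finset.mem_image_of_mem (fun s : Fin n → ℕ => s a) ht)
        (Finset.mem_image_of_mem (fun s : Fin n → ℕ => s a) hs)
    | succ j =>
      simp only [List.take_succ_cons, List.mem_cons, forall_eq_or_imp] at h
      simp only [tupleCode, List.getElem_cons_succ, h.1]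
      exact ih (D := D.filter (fun u => u a = s a)) (Finset.mem_filter.2 ⟨ht, h.1⟩)
        (Finset.mem_filter.2 ⟨hs, rfl⟩) j (by simpa using hj) h.2

lemma tupleCode_getElem_le_dbFanout {n : ℕ} {t : Fin n → ℕ} (L : List (Fin n))
    {D : Finset (Fin n → ℕ)} (ht : t ∈ D) (j : ℕ) (hj : j < (tupleCode t D L).length) :
    1 ≤ (tupleCode t D L)[j] ∧
      (tupleCode t D L)[j] ≤ dbFanout ((tupleCode t D L).take j) D L := by
  induction L generalizing D j with
  | nil => simp [tupleCode] at hj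
  | cons a L ih =>
    have hmem := Finset.mem_image_of_mem (fun s : Fin n → ℕ => s a) ht
    cases j with
    | zero => exact ⟨one_le_rankIn _ _, rankIn_le_card hmem⟩
    | succ j =>
      have hw := nthVal_rankIn hmem
      simp only [tupleCode, List.getElem_cons_succ, List.take_succ_cons, dbFanout]
      rw [hw]
      exact ih (D := D.filter (fun u => u a = t a)) (Finset.mem_filter.2 ⟨ht, rfl⟩) j
        (Nat.lt_of_succ_lt_succ hj)

lemma exists_eq_take_tupleCode {n : ℕ} (L : List (Fin n)) {D : Finset (Fin n → ℕ)}
    (hD : D.Nonempty) (x : List ℕ) (hlen : x.length ≤ L.length)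
    (hx : ∀ (j : ℕ) (hj : j < x.length), 1 ≤ x[j] ∧ x[j] ≤ dbFanout (x.take j) D L) :
    ∃ t ∈ D, x = (tupleCode t D L).take x.length := by
  induction L generalizing D x with
  | nil =>
    obtain ⟨t, ht⟩ := hD
    have : x = [] := by simpa using hlen
    exact ⟨t, ht, by simp [this]⟩
  | cons a L ih =>
    cases x with
    | nil =>
      obtain ⟨t, ht⟩ := hD
      exact ⟨t, ht, by simp⟩
    | cons i xs =>
      have h0 := hx 0 (by simp)
      simp only [List.getElem_cons_zero, List.take_zero, dbFanout] at h0
      have hmem := nthVal_mem h0.1 h0.2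
      obtain ⟨u, hu, hua⟩ := Finset.mem_image.1 hmem
      obtain ⟨t, ht, hxs⟩ := ih
        (D := D.filter (fun s => s a = nthVal (D.image (fun t => t a)) i))
        ⟨u, Finset.mem_filter.2 ⟨hu, hua⟩⟩ xs (by simpa using hlen)
        (fun j hj => hx (j + 1) (Nat.succ_lt_succ hj))
      obtain ⟨htD, hta⟩ := Finset.mem_filter.1 ht
      refine ⟨t, htD, ?_⟩
      simp only [tupleCode, List.length_cons, List.take_succ_cons, hta]
      rw [rankIn_nthVal h0.1 h0.2, ← hxs]

lemma validIdx_dbFanout_iff {n : ℕ} (D : Finset (Fin n → ℕ)) (L : List (Fin n)) (x : List ℕ) :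
    ValidIdx (fun y => dbFanout y D L) L.length x ↔
      x ≠ [] ∧ x.length ≤ L.length ∧ ∃ t ∈ D, x = (tupleCode t D L).take x.length := by
  constructor
  · rintro ⟨hne, hlen, hx⟩
    refine ⟨hne, hlen, exists_eq_take_tupleCode L ?_ x hlen fun j hj => hx ⟨j, hj⟩⟩
    have h0 := hx ⟨0, List.length_pos_iff.2 hne⟩
    rcases D.eq_empty_or_nonempty with rfl | h
    · cases L with
      | nil => simp [dbFanout] at h0; omega
      | cons a L => simp [dbFanout] at h0; omega
    · exact h
  · rintro ⟨hne, hlen, t, ht, hx⟩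
    refine ⟨hne, hlen, fun ⟨j, hj⟩ => ?_⟩
    have hj' : j < (tupleCode t D L).length := by rw [length_tupleCode]; omega
    have h := tupleCode_getElem_le_dbFanout L ht j hj'
    have e1 : x[j] = (tupleCode t D L)[j] := by
      rw [List.getElem_of_eq hx, List.getElem_take]
    have e2 : x.take j = (tupleCode t D L).take j := by
      rw [hx, List.take_take, min_eq_left hj.le]
    simpa [e1, e2] using h

/-! Variables as pairs of a tuple and an attribute. -/

/-- The index tuple of the variable holding the value of the tuple `t` at the attribute `a`. -/
def nodeIdx {n : ℕ} (D : Finset (Fin n → ℕ)) (L : List (Fin n)) (t : Fin n → ℕ) (a : Fin n) :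
    List ℕ :=
  (tupleCode t D L).take (L.idxOf a + 1)

lemma length_nodeIdx {n : ℕ} (D : Finset (Fin n → ℕ)) {L : List (Fin n)} (t : Fin n → ℕ)
    {a : Fin n} (ha : a ∈ L) : (nodeIdx D L t a).length = L.idxOf a + 1 := by
  have := List.idxOf_lt_length_iff.2 ha
  rw [nodeIdx, List.length_take, length_tupleCode]
  omega

lemma getElem?_length_nodeIdx {n : ℕ} (D : Finset (Fin n → ℕ)) {L : List (Fin n)}
    (t : Fin n → ℕ) {a : Fin n} (ha : a ∈ L) :
    L[(nodeIdx D L t a).length - 1]? = some a := by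
  rw [length_nodeIdx D t ha, Nat.add_sub_cancel]
  exact List.getElem?_idxOf ha

lemma validIdx_nodeIdx {n : ℕ} {D : Finset (Fin n → ℕ)} {L : List (Fin n)} {t : Fin n → ℕ}
    {a : Fin n} (ht : t ∈ D) (ha : a ∈ L) :
    ValidIdx (fun y => dbFanout y D L) L.length (nodeIdx D L t a) := by
  have hl := length_nodeIdx D t ha
  have := List.idxOf_lt_length_iff.2 ha
  refine (validIdx_dbFanout_iff D L _).2 ⟨?_, by omega, t, ht, by rw [hl, nodeIdx]⟩
  rw [← List.length_pos_iff]
  omega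

lemma exists_eq_nodeIdx {n : ℕ} {D : Finset (Fin n → ℕ)} {L : List (Fin n)} (hL : L.Nodup)
    {x : List ℕ} (hx : ValidIdx (fun y => dbFanout y D L) L.length x) :
    ∃ t ∈ D, ∃ a ∈ L, x = nodeIdx D L t a := by
  obtain ⟨hne, hlen, t, ht, h⟩ := (validIdx_dbFanout_iff D L x).1 hx
  have hpos := List.length_pos_iff.2 hne
  refine ⟨t, ht, L[x.length - 1], List.getElem_mem _, ?_⟩
  rw [nodeIdx, hL.idxOf_getElem, Nat.sub_add_cancel hpos]
  exact h

lemma mem_take_idxOf_succ {n : ℕ} {L : List (Fin n)} {a b : Fin n} (ha : a ∈ L) :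
    b ∈ L.take (L.idxOf a + 1) ↔ b ∈ L.take (L.idxOf a) ∨ b = a := by
  have h := List.idxOf_lt_length_iff.2 ha
  rw [List.take_succ_eq_append_getElem h]
  simp

lemma nodeIdx_eq_iff {n : ℕ} {D : Finset (Fin n → ℕ)} {L : List (Fin n)} {t s : Fin n → ℕ}
    {a : Fin n} (ht : t ∈ D) (hs : s ∈ D) (ha : a ∈ L) :
    nodeIdx D L t a = nodeIdx D L s a ↔
      (∀ b ∈ L.take (L.idxOf a), t b = s b) ∧ t a = s a := by
  rw [nodeIdx, nodeIdx, take_tupleCode_eq_iff L ht hs]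
  simp only [mem_take_idxOf_succ ha]
  grind

lemma nodeIdx_eq_append {n : ℕ} (D : Finset (Fin n → ℕ)) {L : List (Fin n)} (t : Fin n → ℕ)
    {a : Fin n} (ha : a ∈ L) :
    nodeIdx D L t a = (tupleCode t D L).take (L.idxOf a) ++
      [(tupleCode t D L)[L.idxOf a]'(by
        rw [length_tupleCode]; exact List.idxOf_lt_length_iff.2 ha)] := by
  rw [nodeIdx, List.take_succ_eq_append_getElem]

lemma validIdx_append_singleton_iff (f : List ℕ → ℕ) (ar : ℕ) (x : List ℕ) (i : ℕ) :
    ValidIdx f ar (x ++ [i]) ↔ x.length + 1 ≤ ar ∧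
      (∀ (j : ℕ) (hj : j < x.length), 1 ≤ x[j] ∧ x[j] ≤ f (x.take j)) ∧ 1 ≤ i ∧ i ≤ f x := by
  constructor
  · rintro ⟨-, hlen, h⟩
    refine ⟨by simpa using hlen, fun j hj => ?_, ?_⟩
    · have := h ⟨j, by simp; omega⟩
      simpa [List.getElem_append_left hj, List.take_append_of_le_length hj.le] using this
    · simpa using h ⟨x.length, by simp⟩
  · rintro ⟨hlen, h, hi⟩
    refine ⟨by simp, by simpa using hlen, fun ⟨j, hj⟩ => ?_⟩
    rcases Nat.lt_or_ge j x.length with h' | h'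
    · simpa [List.getElem_append_left h', List.take_append_of_le_length h'.le] using h j h'
    · have : j = x.length := by simp at hj; omega
      subst this
      simpa using hi

lemma IsInstVal.lt_of_lt {f : List ℕ → ℕ} {ar : ℕ} {v : List ℕ → ℕ} (hv : IsInstVal f ar v)
    {x : List ℕ} {i k : ℕ} (hik : i < k) (hi : ValidIdx f ar (x ++ [i]))
    (hk : ValidIdx f ar (x ++ [k])) : v (x ++ [i]) < v (x ++ [k]) := by
  induction k, hik using Nat.le_induction with
  | base => exact hv x i hi hk
  | succ k hik ih =>
    have hm : ValidIdx f ar (x ++ [k]) := by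
      rw [validIdx_append_singleton_iff] at hi hk ⊢
      exact ⟨hk.1, hk.2.1, by omega, by omega⟩
    exact (ih hm).trans (hv x k hm hk)

lemma isInstVal_dbFanout_iff {n : ℕ} {D : Finset (Fin n → ℕ)} {L : List (Fin n)} (hL : L.Nodup)
    (v : List ℕ → ℕ) :
    IsInstVal (fun y => dbFanout y D L) L.length v ↔
      ∀ t ∈ D, ∀ s ∈ D, ∀ a ∈ L, (∀ b ∈ L.take (L.idxOf a), t b = s b) → t a < s a →
        v (nodeIdx D L t a) < v (nodeIdx D L s a) := by
  constructor
  · intro hv t ht s hs a ha hag hlt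
    have hj := List.idxOf_lt_length_iff.2 ha
    have hvt := validIdx_nodeIdx ht ha
    have hvs := validIdx_nodeIdx hs ha
    have hc := (tupleCode_getElem_lt_iff L ht hs _ hj hag).2 (by simpa using hlt)
    rw [nodeIdx_eq_append D t ha] at hvt ⊢
    rw [nodeIdx_eq_append D s ha] at hvs ⊢
    rw [(take_tupleCode_eq_iff L ht hs _).2 hag] at hvt ⊢
    exact hv.lt_of_lt hc hvt hvs
  · intro h x i hi hi'
    obtain ⟨t, ht, a, ha, e⟩ := exists_eq_nodeIdx hL hi
    obtain ⟨s, hs, a', ha', e'⟩ := exists_eq_nodeIdx hL hi'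
    have haa : a' = a := by
      have h1 := getElem?_length_nodeIdx D t ha
      have h2 := getElem?_length_nodeIdx D s ha'
      rw [← e] at h1
      rw [← e'] at h2
      simp only [List.length_append, List.length_singleton] at h1 h2
      exact Option.some_injective _ (h2.symm.trans h1)
    subst haa
    rw [e, e']
    rw [nodeIdx_eq_append D t ha] at e
    rw [nodeIdx_eq_append D s ha] at e'
    obtain ⟨e1, e2⟩ := List.append_inj' e rfl
    obtain ⟨e1', e2'⟩ := List.append_inj' e' rfl
    have hag := (take_tupleCode_eq_iff L ht hs _).1 (e1.symm.trans e1')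
    refine h t ht s hs a' ha hag ?_
    have hc := tupleCode_getElem_lt_iff L ht hs _ (List.idxOf_lt_length_iff.2 ha) hag
    simp only [List.cons.injEq, and_true] at e2 e2'
    simpa [← e2, ← e2'] using hc

lemma dbValList_nodeIdx {n : ℕ} {D : Finset (Fin n → ℕ)} {L : List (Fin n)} {t : Fin n → ℕ}
    {a : Fin n} (ht : t ∈ D) (ha : a ∈ L) :
    (dbValList (nodeIdx D L t a) D L).getD ((nodeIdx D L t a).length - 1) 0 = t a := by
  have h := List.idxOf_lt_length_iff.2 ha
  rw [length_nodeIdx D t ha, nodeIdx, dbValList_take_tupleCode L ht, Nat.add_sub_cancel,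
    List.getD_eq_getElem _ _ (by simp; omega)]
  simp

lemma nodup_attrList {n : ℕ} {ι : Type} (attrs : ι → Finset (Fin n)) {ρ : List (Fin n)}
    (hρ : ρ.Nodup) (R : ι) : (attrList attrs ρ R).Nodup := hρ.filter _

lemma isWitness_dbShape_iff {n : ℕ} {ι : Type} (attrs : ι → Finset (Fin n)) {ρ : List (Fin n)}
    (hρ : ρ.Nodup) (DB : ι → Finset (Fin n → ℕ)) (v : ι → List ℕ → ℕ) (W : ι → List ℕ) :
    IsWitness attrs ρ (dbShape attrs ρ DB) v W ↔
      (∀ R, attrList attrs ρ R ≠ []) ∧ ∃ τ : ι → Fin n → ℕ,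
        (∀ R, τ R ∈ DB R ∧ W R = tupleCode (τ R) (DB R) (attrList attrs ρ R)) ∧
        ∃ t : Fin n → ℕ, ∀ R, ∀ a ∈ attrList attrs ρ R,
          v R (nodeIdx (DB R) (attrList attrs ρ R) (τ R) a) = t a := by
  constructor
  · rintro ⟨hW, t, ht⟩
    have hW' := fun R => (validIdx_dbFanout_iff (DB R) (attrList attrs ρ R) (W R)).1 (hW R).1
    choose hne hlen τ hτ hWτ using hW'
    have hlen' : ∀ R, (W R).length = (attrList attrs ρ R).length := fun R => (hW R).2
    have hWc : ∀ R, W R = tupleCode (τ R) (DB R) (attrList attrs ρ R) := fun R => by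
      have := hWτ R
      rwa [hlen' R, ← length_tupleCode (τ R) _ (DB R), List.take_length] at this
    refine ⟨fun R h0 => hne R ?_, τ, fun R => ⟨hτ R, hWc R⟩, t, fun R a ha => ?_⟩
    · have := hlen' R
      rw [h0] at this
      exact List.length_eq_zero_iff.1 this
    · rw [nodeIdx, ← hWc R]
      exact ht R _ a (List.getElem?_idxOf ha)
  · rintro ⟨hne, τ, hτ, t, ht⟩
    have hlen : ∀ R, (W R).length = (attrList attrs ρ R).length := fun R => by
      rw [(hτ R).2, length_tupleCode]
    refine ⟨fun R => ⟨(validIdx_dbFanout_iff _ _ _).2 ⟨?_, (hlen R).le, τ R, (hτ R).1, ?_⟩, hlen R⟩,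
      t, fun R j a hj => ?_⟩
    · rw [← List.length_pos_iff, hlen R]
      exact List.length_pos_iff.2 (hne R)
    · rw [List.take_of_length_le (by rw [hlen R, length_tupleCode]), (hτ R).2]
    · obtain ⟨hjl, rfl⟩ := List.getElem?_eq_some_iff.1 hj
      rw [← ht R _ (List.getElem_mem hjl), nodeIdx, (nodup_attrList attrs hρ R).idxOf_getElem,
        (hτ R).2]

/-! Transfer of certificates between two attribute orders. -/

lemma take_idxOf_eq_takeWhile {α : Type*} [DecidableEq α] (L : List α) (a : α) :
    L.take (L.idxOf a) = L.takeWhile (fun b => decide (b ≠ a)) := by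
  induction L with
  | nil => rfl
  | cons c L ih => by_cases h : c = a <;> simp_all

lemma mem_takeWhile_of_mem_takeWhile_filter {α : Type*} [DecidableEq α] {L : List α} {a b c : α}
    (hac : a ≠ c)
    (h : b ∈ (L.filter (fun d => decide (d ≠ c))).takeWhile (fun d => decide (d ≠ a))) :
    b ∈ L.takeWhile (fun d => decide (d ≠ a)) := by
  induction L with
  | nil => simp at h
  | cons d L ih =>
    rw [List.filter_cons] at h
    rw [List.takeWhile_cons]
    grind [List.takeWhile_cons]

lemma mem_attrList {n : ℕ} {ι : Type} {attrs : ι → Finset (Fin n)} {ρ : List (Fin n)}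
    (hall : ∀ a, a ∈ ρ) {R : ι} {a : Fin n} : a ∈ attrList attrs ρ R ↔ a ∈ attrs R := by
  simp [attrList, hall a]

lemma mem_take_idxOf_attrList_of_moveEnd {n : ℕ} {ι : Type} (attrs : ι → Finset (Fin n))
    {ρ : List (Fin n)} (hρ : ρ.Nodup) (hall : ∀ a, a ∈ ρ) {B : Fin n} {R : ι} {a b : Fin n}
    (ha : a ∈ attrs R) (haB : a ≠ B)
    (h : b ∈ (attrList attrs (ρ.erase B ++ [B]) R).take
      ((attrList attrs (ρ.erase B ++ [B]) R).idxOf a)) :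
    b ∈ (attrList attrs ρ R).take ((attrList attrs ρ R).idxOf a) := by
  have hmem : a ∈ (ρ.erase B).filter (fun c => decide (c ∈ attrs R)) := by
    simp [hρ.mem_erase_iff, hall a, ha, haB]
  rw [attrList, List.filter_append, List.idxOf_append_of_mem hmem,
    List.take_append_of_le_length List.idxOf_le_length, take_idxOf_eq_takeWhile] at h
  rw [take_idxOf_eq_takeWhile]
  apply mem_takeWhile_of_mem_takeWhile_filter haB
  convert h using 2
  rw [hρ.erase_eq_filter, attrList, List.filter_filter, List.filter_filter]
  refine List.filter_congr fun c _ => ?_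
  by_cases hc : c = B <;> simp [hc]

/-- A certificate for the order `ρ` yields one that is no larger for any order `ρ'` in which every
attribute `a ≠ B` has no predecessor that it lacks in `ρ`, provided `B` is private. -/
theorem exists_isCert_card_le {n : ℕ} {ι : Type} [DecidableEq ι] (attrs : ι → Finset (Fin n))
    {ρ ρ' : List (Fin n)} (hρ : ρ.Nodup) (hall : ∀ a, a ∈ ρ) (hρ' : ρ'.Nodup)
    (hall' : ∀ a, a ∈ ρ') (B : Fin n) (R₀ : ι) (hpriv : ∀ R, B ∈ attrs R → R = R₀)
    (hord : ∀ R, ∀ a ∈ attrs R, a ≠ B →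
      ∀ b ∈ (attrList attrs ρ' R).take ((attrList attrs ρ' R).idxOf a),
        b ∈ (attrList attrs ρ R).take ((attrList attrs ρ R).idxOf a))
    (DB : ι → Finset (Fin n → ℕ)) (C : Finset (Comp ι))
    (hC : IsCert attrs ρ (dbShape attrs ρ DB) C)
    (hCsat : ∀ c ∈ C, SatComp (dbValue attrs ρ DB) c) :
    ∃ C₂ : Finset (Comp ι), IsCert attrs ρ' (dbShape attrs ρ' DB) C₂ ∧
      (∀ c ∈ C₂, SatComp (dbValue attrs ρ' DB) c) ∧ C₂.card ≤ C.card := by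
  classical
  let N : ι → (Fin n → ℕ) → Fin n → List ℕ := fun R => nodeIdx (DB R) (attrList attrs ρ R)
  let N' : ι → (Fin n → ℕ) → Fin n → List ℕ := fun R => nodeIdx (DB R) (attrList attrs ρ' R)
  have hm : ∀ {R a}, a ∈ attrList attrs ρ R ↔ a ∈ attrs R := mem_attrList hall
  have hm' : ∀ {R a}, a ∈ attrList attrs ρ' R ↔ a ∈ attrs R := mem_attrList hall'
  have hφ : ∃ φ : ι → List ℕ → List ℕ, ∀ R, ∀ t ∈ DB R, ∀ a ∈ attrs R, a ≠ B →
      φ R (N R t a) = N' R t a := by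
    refine ⟨fun R x => if h : ∃ p : (Fin n → ℕ) × Fin n, p.1 ∈ DB R ∧ p.2 ∈ attrs R ∧
      x = N R p.1 p.2 then N' R h.choose.1 h.choose.2 else [], fun R t ht a ha haB => ?_⟩
    have h : ∃ p : (Fin n → ℕ) × Fin n, p.1 ∈ DB R ∧ p.2 ∈ attrs R ∧ N R t a = N R p.1 p.2 :=
      ⟨(t, a), ht, ha, rfl⟩
    simp only [dif_pos h]
    obtain ⟨h1, h2, h3⟩ := h.choose_spec
    generalize h.choose = p at h1 h2 h3
    obtain ⟨s, b⟩ := p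
    have hab : b = a := by
      have e1 := getElem?_length_nodeIdx (DB R) t (hm.2 ha)
      have e2 := getElem?_length_nodeIdx (DB R) s (hm.2 h2)
      simp only [N] at h3
      rw [h3] at e1
      exact Option.some_injective _ (e2.symm.trans e1)
    simp only at h1 h3 hab
    subst hab
    obtain ⟨hag, hb⟩ := (nodeIdx_eq_iff ht h1 (hm.2 ha)).1 h3
    exact (nodeIdx_eq_iff h1 ht (hm'.2 ha)).2
      ⟨fun c hc => (hag c (hord R b ha haB c hc)).symm, hb.symm⟩
  obtain ⟨φ, hφ⟩ := hφ
  have hdb : ∀ R, ∀ t ∈ DB R, ∀ a ∈ attrs R, dbValue attrs ρ DB R (N R t a) = t a :=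
    fun R t ht a ha => dbValList_nodeIdx ht (hm.2 ha)
  have hdb' : ∀ R, ∀ t ∈ DB R, ∀ a ∈ attrs R, dbValue attrs ρ' DB R (N' R t a) = t a :=
    fun R t ht a ha => dbValList_nodeIdx ht (hm'.2 ha)
  have hlast : ∀ R t, ∀ a ∈ attrs R,
      (attrList attrs ρ R)[(N R t a).length - 1]? = some a :=
    fun R t a ha => getElem?_length_nodeIdx _ _ (hm.2 ha)
  have hlast' : ∀ R t, ∀ a ∈ attrs R,
      (attrList attrs ρ' R)[(N' R t a).length - 1]? = some a :=
    fun R t a ha => getElem?_length_nodeIdx _ _ (hm'.2 ha)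
  have hcomp : ∀ c ∈ C, ∃ t ∈ DB c.R, ∃ s ∈ DB c.S, ∃ a ∈ attrs c.R, a ∈ attrs c.S ∧
      c.x = N c.R t a ∧ c.y = N c.S s a := by
    intro c hc
    obtain ⟨hx, hy, hxy⟩ := hC.1 c hc
    obtain ⟨t, ht, a, ha, ex⟩ := exists_eq_nodeIdx (nodup_attrList attrs hρ c.R) hx
    obtain ⟨s, hs, b, hb, ey⟩ := exists_eq_nodeIdx (nodup_attrList attrs hρ c.S) hy
    rw [ex, ey, getElem?_length_nodeIdx _ _ ha, getElem?_length_nodeIdx _ _ hb] at hxy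
    obtain rfl := Option.some_injective _ hxy
    exact ⟨t, ht, s, hs, a, hm.1 ha, hm.1 hb, ex, ey⟩
  let C₂ : Finset (Comp ι) :=
    (C.filter (fun c => (attrList attrs ρ c.R)[c.x.length - 1]? ≠ some B)).image
      (fun c => ⟨c.R, φ c.R c.x, c.S, φ c.S c.y, c.o⟩)
  have hC₂ : ∀ c' ∈ C₂, ∃ R S o t s a, t ∈ DB R ∧ s ∈ DB S ∧ a ∈ attrs R ∧ a ∈ attrs S ∧
      ⟨R, N R t a, S, N S s a, o⟩ ∈ C ∧ c' = ⟨R, N' R t a, S, N' S s a, o⟩ := by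
    intro c' hc'
    obtain ⟨c, hc, rfl⟩ := Finset.mem_image.1 hc'
    obtain ⟨hc, hcB⟩ := Finset.mem_filter.1 hc
    obtain ⟨t, ht, s, hs, a, ha, hb, ex, ey⟩ := hcomp c hc
    rw [ex, hlast c.R t a ha] at hcB
    have haB : a ≠ B := fun h => hcB (h ▸ rfl)
    obtain ⟨R, x, S, y, o⟩ := c
    simp only at ex ey ht hs ha hb ⊢
    subst ex ey
    exact ⟨R, S, o, t, s, a, ht, hs, ha, hb, hc, by rw [hφ R t ht a ha haB, hφ S s hs a hb haB]⟩
  refine ⟨C₂, ⟨?_, ?_⟩, ?_, Finset.card_image_le.trans (Finset.card_filter_le _ _)⟩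
  · intro c' hc'
    obtain ⟨R, S, o, t, s, a, ht, hs, ha, hb, -, rfl⟩ := hC₂ c' hc'
    refine ⟨validIdx_nodeIdx ht (hm'.2 ha), validIdx_nodeIdx hs (hm'.2 hb), ?_⟩
    exact (hlast' R t a ha).trans (hlast' S s a hb).symm
  · let lift : (ι → List ℕ → ℕ) → ι → List ℕ → ℕ := fun v R x =>
      if (attrList attrs ρ R)[x.length - 1]? = some B then dbValue attrs ρ DB R x
      else v R (φ R x)
    have lift_B : ∀ v R, ∀ t ∈ DB R, B ∈ attrs R → lift v R (N R t B) = t B := by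
      intro v R t ht hB
      simp only [lift]
      rw [if_pos (hlast R t B hB), hdb R t ht B hB]
    have lift_ne : ∀ v R, ∀ t ∈ DB R, ∀ a ∈ attrs R, a ≠ B →
        lift v R (N R t a) = v R (N' R t a) := by
      intro v R t ht a ha haB
      simp only [lift]
      rw [if_neg (by rw [hlast R t a ha]; simpa using haB), hφ R t ht a ha haB]
    have lift_inst : ∀ v : ι → List ℕ → ℕ,
        (∀ R, IsInstVal (dbShape attrs ρ' DB R) (arity attrs ρ' R) (v R)) →
        ∀ R, IsInstVal (dbShape attrs ρ DB R) (arity attrs ρ R) (lift v R) := by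
      intro v hv R
      refine (isInstVal_dbFanout_iff (nodup_attrList attrs hρ R) _).2
        fun t ht s hs a ha hag hlt => ?_
      have hv' := (isInstVal_dbFanout_iff (nodup_attrList attrs hρ' R) _).1 (hv R)
      change lift v R (N R t a) < lift v R (N R s a)
      rw [hm] at ha
      by_cases haB : a = B
      · subst haB
        rwa [lift_B v R t ht ha, lift_B v R s hs ha]
      · rw [lift_ne v R t ht a ha haB, lift_ne v R s hs a ha haB]
        exact hv' t ht s hs a (hm'.2 ha) (fun b hb => hag b (hord R a ha haB b hb)) hlt
    have lift_sat : ∀ v : ι → List ℕ → ℕ, (∀ c ∈ C₂, SatComp v c) →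
        ∀ c ∈ C, SatComp (lift v) c := by
      intro v hv c hc
      obtain ⟨t, ht, s, hs, a, ha, hb, ex, ey⟩ := hcomp c hc
      have hsat := hCsat c hc
      rw [SatComp, ex, ey] at hsat ⊢
      by_cases haB : a = B
      · subst haB
        rwa [lift_B v _ t ht ha, lift_B v _ s hs hb, ← hdb _ t ht a ha, ← hdb _ s hs a hb]
      · rw [lift_ne v _ t ht a ha haB, lift_ne v _ s hs a hb haB, ← hφ _ t ht a ha haB,
          ← hφ _ s hs a hb haB, ← ex, ← ey]
        refine hv _ (Finset.mem_image_of_mem _ (Finset.mem_filter.2 ⟨hc, ?_⟩))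
        rw [ex, hlast _ t a ha]
        simpa using haB
    have transfer : ∀ v w : ι → List ℕ → ℕ,
        (∀ W, IsWitness attrs ρ (dbShape attrs ρ DB) (lift v) W →
          IsWitness attrs ρ (dbShape attrs ρ DB) (lift w) W) →
        ∀ W, IsWitness attrs ρ' (dbShape attrs ρ' DB) v W →
          IsWitness attrs ρ' (dbShape attrs ρ' DB) w W := by
      intro v w hvw W hW
      obtain ⟨hne, τ, hτ, t, ht⟩ := (isWitness_dbShape_iff attrs hρ' DB v W).1 hW
      have hlift := (isWitness_dbShape_iff attrs hρ DB (lift v)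
        (fun R => tupleCode (τ R) (DB R) (attrList attrs ρ R))).2
        ⟨fun R h0 => ?_, τ, fun R => ⟨(hτ R).1, rfl⟩, Function.update t B (τ R₀ B), ?_⟩
      · obtain ⟨-, σ, hσ, u, hu⟩ := (isWitness_dbShape_iff attrs hρ DB _ _).1 (hvw _ hlift)
        refine (isWitness_dbShape_iff attrs hρ' DB w W).2
          ⟨hne, τ, hτ, Function.update u B (w R₀ (N' R₀ (τ R₀) B)), fun R a ha => ?_⟩
        rw [hm'] at ha
        by_cases haB : a = B
        · subst haB
          obtain rfl := hpriv R ha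
          simp [N']
        · rw [Function.update_of_ne haB, ← hu R a (hm.2 ha)]
          change w R (N' R (τ R) a) = lift w R (N R (σ R) a)
          have : N R (σ R) a = N R (τ R) a := by
            simp only [N, nodeIdx]
            rw [← (hσ R).2]
          rw [this, lift_ne w R _ (hτ R).1 a ha haB]
      · obtain ⟨a, ha⟩ := List.exists_mem_of_ne_nil _ (hne R)
        have := hm.2 (hm'.1 ha)
        simp [h0] at this
      · intro R a ha
        rw [hm] at ha
        change lift v R (N R (τ R) a) = _
        by_cases haB : a = B
        · subst haB
          obtain rfl := hpriv R ha
          rw [lift_B v R _ (hτ R).1 ha, Function.update_self]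
        · rw [lift_ne v R _ (hτ R).1 a ha haB, Function.update_of_ne haB]
          exact ht R a (hm'.2 ha)
    intro v w hv hw hvs hws W
    have key := hC.2 (lift v) (lift w) (lift_inst v hv) (lift_inst w hw) (lift_sat v hvs)
      (lift_sat w hws)
    exact ⟨transfer v w (fun W => (key W).1) W, transfer w v (fun W => (key W).2) W⟩
  · intro c' hc'
    obtain ⟨R, S, o, t, s, a, ht, hs, ha, hb, hc, rfl⟩ := hC₂ c' hc'
    have := hCsat _ hc
    simp only [SatComp] at this ⊢
    rw [hdb R t ht a ha, hdb S s hs a hb] at this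
    rwa [hdb' R t ht a ha, hdb' S s hs a hb]

/-- Let `B` be a private attribute (it occurs in the single relation `R₀`), let `ρ` be any
GAO and `ρ' = (ρ.erase B) ++ [B]` the GAO obtained by moving `B` to the end.  For a fixed
database `DB`, minimum-size certificates satisfied by the database indexed consistently
with `ρ'` are no larger than those for `ρ`. -/
theorem stmt_7 {n : ℕ} {ι : Type} [DecidableEq ι]
    (attrs : ι → Finset (Fin n)) (ρ : List (Fin n)) (hnd : ρ.Nodup) (hall : ∀ a : Fin n, a ∈ ρ)
    (B : Fin n) (R₀ : ι) (hB : B ∈ attrs R₀) (hpriv : ∀ R : ι, B ∈ attrs R → R = R₀)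
    (DB : ι → Finset (Fin n → ℕ))
    (hsupp : ∀ R, ∀ t ∈ DB R, ∀ a, a ∉ attrs R → t a = 0)
    (C C' : Finset (Comp ι))
    -- `C` is a minimum-size certificate for the database indexed according to `ρ`
    (hC : IsCert attrs ρ (dbShape attrs ρ DB) C)
    (hCsat : ∀ c ∈ C, SatComp (dbValue attrs ρ DB) c)
    (hCmin : ∀ C₂ : Finset (Comp ι), IsCert attrs ρ (dbShape attrs ρ DB) C₂ →
      (∀ c ∈ C₂, SatComp (dbValue attrs ρ DB) c) → C.card ≤ C₂.card)
    -- `C'` is a minimum-size certificate for the database indexed according to `ρ'`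
    (hC' : IsCert attrs (ρ.erase B ++ [B]) (dbShape attrs (ρ.erase B ++ [B]) DB) C')
    (hC'sat : ∀ c ∈ C', SatComp (dbValue attrs (ρ.erase B ++ [B]) DB) c)
    (hC'min : ∀ C₂ : Finset (Comp ι),
      IsCert attrs (ρ.erase B ++ [B]) (dbShape attrs (ρ.erase B ++ [B]) DB) C₂ →
      (∀ c ∈ C₂, SatComp (dbValue attrs (ρ.erase B ++ [B]) DB) c) → C'.card ≤ C₂.card) :
    C'.card ≤ C.card := by
  have hnd' : (ρ.erase B ++ [B]).Nodup := by
    simpa [List.nodup_append, hnd.erase B, hnd.mem_erase_iff] using fun a h _ => h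
  have hall' : ∀ a : Fin n, a ∈ ρ.erase B ++ [B] := fun a => by
    by_cases h : a = B <;> simp [h, hnd.mem_erase_iff, hall a]
  obtain ⟨C₂, h1, h2, h3⟩ := exists_isCert_card_le attrs hnd hall hnd' hall' B R₀ hpriv
    (fun R a ha haB b hb => mem_take_idxOf_attrList_of_moveEnd attrs hnd hall ha haB hb)
    DB C hC hCsat
  exact (hC'min C₂ h1 h2).trans h3
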